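/- arXiv:2510.10768 — 2 statements merged into one kernel-verified Lean document; each statement's English description precedes it below -/
import Mathlib

section
/- A matrix $M \in \mathbb{R}^{4\times 4}$ belongs to $\widehat{G}$ if and only if there exist $\varepsilon \in \{1,-1\}$ and real numbers $a_1,a_2,b_1,b_2,c_1,c_2,d_1,d_2$ with $a_1d_1 + a_2d_2 - b_1c_1 - b_2c_2 = 1$ and $a_1d_2 + a_2d_1 - b_2c_1 - b_1c_2 = 0$ such that $M = \begin{pmatrix} a_1 & a_2 & b_1 & b_2 \\ \varepsilon a_2 & \varepsilon a_1 & \varepsilon b_2 & \varepsilon b_1 \\ c_1 & c_2 & d_1 & d_2 \\ \varepsilon c_2 & \varepsilon c_1 & \varepsilon d_2 & \varepsilon d_1 \end{pmatrix}$. -/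
open Matrix Complex

noncomputable section

/-- `J₄ = [[0, I₂], [-I₂, 0]]`. -/
def J4 : Matrix (Fin 4) (Fin 4) ℝ :=
  !![0,0,1,0; 0,0,0,1; -1,0,0,0; 0,-1,0,0]

/-- The symplectic group `Sp(4,ℝ)`. -/
def Sp4 : Set (Matrix (Fin 4) (Fin 4) ℝ) :=
  {M | IsUnit M.det ∧ Mᵀ * J4 * M = J4}

/-- `Q = [[q, 0], [0, q]]` with `q = [[0,1],[1,0]]`. -/
def QM : Matrix (Fin 4) (Fin 4) ℝ :=
  !![0,1,0,0; 1,0,0,0; 0,0,0,1; 0,0,1,0]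

/-- Upper-left 2×2 block (complexified). -/
def blkA (M : Matrix (Fin 4) (Fin 4) ℝ) : Matrix (Fin 2) (Fin 2) ℂ :=
  Matrix.of fun i j => (M (Fin.castAdd 2 i) (Fin.castAdd 2 j) : ℂ)

def blkB (M : Matrix (Fin 4) (Fin 4) ℝ) : Matrix (Fin 2) (Fin 2) ℂ :=
  Matrix.of fun i j => (M (Fin.castAdd 2 i) (Fin.natAdd 2 j) : ℂ)

def blkC (M : Matrix (Fin 4) (Fin 4) ℝ) : Matrix (Fin 2) (Fin 2) ℂ :=
  Matrix.of fun i j => (M (Fin.natAdd 2 i) (Fin.castAdd 2 j) : ℂ)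

def blkD (M : Matrix (Fin 4) (Fin 4) ℝ) : Matrix (Fin 2) (Fin 2) ℂ :=
  Matrix.of fun i j => (M (Fin.natAdd 2 i) (Fin.natAdd 2 j) : ℂ)

/-- The action `M⟨Ω⟩ = (AΩ + B)(CΩ + D)⁻¹`. -/
def act (M : Matrix (Fin 4) (Fin 4) ℝ) (Ω : Matrix (Fin 2) (Fin 2) ℂ) :
    Matrix (Fin 2) (Fin 2) ℂ :=
  (blkA M * Ω + blkB M) * (blkC M * Ω + blkD M)⁻¹

/-- The Siegel upper half plane of degree 2. -/
def H2 : Set (Matrix (Fin 2) (Fin 2) ℂ) :=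
  {Ω | Ωᵀ = Ω ∧ (Matrix.of fun i j => (Ω i j).im : Matrix (Fin 2) (Fin 2) ℝ).PosDef}

/-- The new kind Siegel upper half space `Ĥ₂ = {Ω ∈ H₂ | Q⟨Ω⟩ = Ω}`. -/
def HHat2 : Set (Matrix (Fin 2) (Fin 2) ℂ) :=
  {Ω | Ω ∈ H2 ∧ act QM Ω = Ω}

/-- `Ĝ = {M ∈ Sp(4,ℝ) | MQ = QM or MQ = -QM}`. -/
def GHat : Set (Matrix (Fin 4) (Fin 4) ℝ) :=
  {M | M ∈ Sp4 ∧ (M * QM = QM * M ∨ M * QM = -(QM * M))}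

theorem J4_mul_J4 : J4 * J4 = -1 := by
  ext i j
  fin_cases i <;> fin_cases j <;> simp [J4, Matrix.mul_apply, Fin.sum_univ_four]

/-- The condition `ᵗM J₄ M = J₄` already forces `M` to be invertible. -/
theorem isUnit_det_of_transpose_mul_J4_mul {M : Matrix (Fin 4) (Fin 4) ℝ}
    (h : Mᵀ * J4 * M = J4) : IsUnit M.det := by
  refine Matrix.isUnit_det_of_left_inverse (B := -(J4 * (Mᵀ * J4))) ?_
  rw [Matrix.neg_mul, Matrix.mul_assoc, h, J4_mul_J4, neg_neg]

/-- A matrix with `MQ = ε QM`, `ε² = 1`, is determined by its first and third rows. -/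
theorem eq_of_mul_QM_eq {M : Matrix (Fin 4) (Fin 4) ℝ} {ε : ℝ} (hε : ε * ε = 1)
    (h : M * QM = ε • (QM * M)) :
    M = !![M 0 0, M 0 1, M 0 2, M 0 3;
           ε * M 0 1, ε * M 0 0, ε * M 0 3, ε * M 0 2;
           M 2 0, M 2 1, M 2 2, M 2 3;
           ε * M 2 1, ε * M 2 0, ε * M 2 3, ε * M 2 2] := by
  have key (i j : Fin 4) : (M * QM) i j = ε * (QM * M) i j := by rw [h]; rfl
  have row (x y : ℝ) (hxy : x = ε * y) : y = ε * x := by rw [hxy, ← mul_assoc, hε, one_mul]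
  have h00 := key 0 0
  have h01 := key 0 1
  have h02 := key 0 2
  have h03 := key 0 3
  have h20 := key 2 0
  have h21 := key 2 1
  have h22 := key 2 2
  have h23 := key 2 3
  simp [QM, Matrix.mul_apply, Fin.sum_univ_four] at h00 h01 h02 h03 h20 h21 h22 h23
  ext i j
  fin_cases i <;> fin_cases j <;> first | rfl | (simp; apply row; assumption)

/-- For the explicit shape, `ᵗM J₄ M = J₄` amounts to two equations. -/
theorem transpose_mul_J4_mul_eq_J4_iff {ε : ℝ} (hε : ε * ε = 1)
    (a1 a2 b1 b2 c1 c2 d1 d2 : ℝ) :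
    (!![a1, a2, b1, b2;
        ε*a2, ε*a1, ε*b2, ε*b1;
        c1, c2, d1, d2;
        ε*c2, ε*c1, ε*d2, ε*d1])ᵀ * J4 *
      !![a1, a2, b1, b2;
         ε*a2, ε*a1, ε*b2, ε*b1;
         c1, c2, d1, d2;
         ε*c2, ε*c1, ε*d2, ε*d1] = J4 ↔
      a1*d1 + a2*d2 - b1*c1 - b2*c2 = 1 ∧ a1*d2 + a2*d1 - b2*c1 - b1*c2 = 0 := by
  constructor
  · intro h
    have h02 := congrFun (congrFun h 0) 2
    have h03 := congrFun (congrFun h 0) 3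
    simp [J4, Matrix.mul_apply, Fin.sum_univ_four] at h02 h03
    constructor
    · linear_combination h02 - (a2*d2 - b2*c2) * hε
    · linear_combination h03 - (a2*d1 - b1*c2) * hε
  · rintro ⟨h1, h2⟩
    ext i j
    fin_cases i <;> fin_cases j <;> simp [J4, Matrix.mul_apply, Fin.sum_univ_four] <;> grind

/-- The explicit shape satisfies `MQ = ε QM`. -/
theorem mul_QM_eq_smul {ε : ℝ} (hε : ε * ε = 1) (a1 a2 b1 b2 c1 c2 d1 d2 : ℝ) :
    !![a1, a2, b1, b2;
       ε*a2, ε*a1, ε*b2, ε*b1;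
       c1, c2, d1, d2;
       ε*c2, ε*c1, ε*d2, ε*d1] * QM =
      ε • (QM * !![a1, a2, b1, b2;
                   ε*a2, ε*a1, ε*b2, ε*b1;
                   c1, c2, d1, d2;
                   ε*c2, ε*c1, ε*d2, ε*d1]) := by
  ext i j
  fin_cases i <;> fin_cases j <;>
    simp [QM, Matrix.mul_apply, Fin.sum_univ_four, ← mul_assoc, hε]

/-- `M ∈ Ĝ` iff `M` has the explicit shape of Proposition 2.1 (1). -/
theorem statement9 (M : Matrix (Fin 4) (Fin 4) ℝ) :
    M ∈ GHat ↔
      ∃ ε a1 a2 b1 b2 c1 c2 d1 d2 : ℝ, (ε = 1 ∨ ε = -1) ∧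
        a1*d1 + a2*d2 - b1*c1 - b2*c2 = 1 ∧
        a1*d2 + a2*d1 - b2*c1 - b1*c2 = 0 ∧
        M = !![a1, a2, b1, b2;
               ε*a2, ε*a1, ε*b2, ε*b1;
               c1, c2, d1, d2;
               ε*c2, ε*c1, ε*d2, ε*d1] := by
  constructor
  · rintro ⟨⟨-, hJ⟩, hQ⟩
    obtain ⟨ε, hε, hQ⟩ : ∃ ε : ℝ, (ε = 1 ∨ ε = -1) ∧ M * QM = ε • (QM * M) := by
      rcases hQ with hQ | hQ
      · exact ⟨1, Or.inl rfl, by rw [hQ, one_smul]⟩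
      · exact ⟨-1, Or.inr rfl, by rw [hQ, neg_one_smul]⟩
    have hsq : ε * ε = 1 := mul_self_eq_one_iff.mpr hε
    have hM := eq_of_mul_QM_eq hsq hQ
    rw [hM] at hJ
    obtain ⟨h1, h2⟩ := (transpose_mul_J4_mul_eq_J4_iff hsq _ _ _ _ _ _ _ _).mp hJ
    exact ⟨ε, _, _, _, _, _, _, _, _, hε, h1, h2, hM⟩
  · rintro ⟨ε, a1, a2, b1, b2, c1, c2, d1, d2, hε, h1, h2, rfl⟩
    have hsq : ε * ε = 1 := mul_self_eq_one_iff.mpr hε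
    have hJ := (transpose_mul_J4_mul_eq_J4_iff hsq a1 a2 b1 b2 c1 c2 d1 d2).mpr ⟨h1, h2⟩
    have hQ := mul_QM_eq_smul hsq a1 a2 b1 b2 c1 c2 d1 d2
    refine ⟨⟨isUnit_det_of_transpose_mul_J4_mul hJ, hJ⟩, ?_⟩
    rcases hε with rfl | rfl
    · exact Or.inl (hQ.trans (one_smul ℝ _))
    · exact Or.inr (hQ.trans (neg_one_smul ℝ _))

end
end

section
/- Let $\varepsilon \in \{1,-1\}$, let $M = \begin{pmatrix} a_1 & a_2 & b_1 & b_2 \\ \varepsilon a_2 & \varepsilon a_1 & \varepsilon b_2 & \varepsilon b_1 \\ c_1 & c_2 & d_1 & d_2 \\ \varepsilon c_2 & \varepsilon c_1 & \varepsilon d_2 & \varepsilon d_1 \end{pmatrix} \in \widehat{G}$, and let $\Omega = \begin{pmatrix} \tau & z \\ z & \tau \end{pmatrix} \in \widehat{\mathbb{H}}_2$. Set $M_1 = \begin{pmatrix} a_1+a_2 & b_1+b_2 \\ c_1+c_2 & d_1+d_2 \end{pmatrix}$, $M_2 = \begin{pmatrix} a_1-a_2 & b_1-b_2 \\ c_1-c_2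 & d_1-d_2 \end{pmatrix} \in SL(2,\mathbb{R})$, acting on complex numbers by $\begin{pmatrix} a & b \\ c & d \end{pmatrix}\langle w\rangle = \frac{aw+b}{cw+d}$. Then $M\langle\Omega\rangle = \begin{pmatrix} \tau_* & z_* \\ z_* & \tau_* \end{pmatrix}$, where $\tau_* = \frac{1}{2}\big(M_1\langle\tau+z\rangle + M_2\langle\tau-z\rangle\big)$ and $z_* = \frac{\varepsilon}{2}\big(M_1\langle\tau+z\rangle - M_2\langle\tau-z\rangle\big)$. -/
open Matrix Complex

noncomputable section

/-- The Möbius action of a real 2×2 matrix on ℂ: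
`[[a,b],[c,d]]⟨w⟩ = (aw + b)/(cw + d)`. -/
def moebius (m : Matrix (Fin 2) (Fin 2) ℝ) (w : ℂ) : ℂ :=
  ((m 0 0 : ℂ) * w + (m 0 1 : ℂ)) / ((m 1 0 : ℂ) * w + (m 1 1 : ℂ))

/-- A real linear form `c * w + d` does not vanish at a point of the upper half plane if `(c, d)`
is a row of a real matrix of determinant one. -/
theorem linear_form_ne_zero_of_im_pos {a b c d : ℝ} (h : a * d - b * c = 1) {w : ℂ}
    (hw : 0 < w.im) : (c : ℂ) * w + d ≠ 0 := by
  intro h0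
  have him := congrArg Complex.im h0
  have hre := congrArg Complex.re h0
  simp at him hre
  rcases him with hc | hc
  · simp [hc] at hre
    simp [hc, hre] at h
  · exact hw.ne' hc

/-- Both `τ + z` and `τ - z` lie in the upper half plane if the symmetric matrix with diagonal `τ`
and off-diagonal `z` lies in the Siegel upper half plane. -/
theorem im_add_pos_and_im_sub_pos_of_mem_H2 {τ z : ℂ} (h : !![τ, z; z, τ] ∈ H2) :
    0 < (τ + z).im ∧ 0 < (τ - z).im := by
  have hp := h.2.dotProduct_mulVec_pos (x := ![1, 1]) (by simp)
  have hm := h.2.dotProduct_mulVec_pos (x := ![1, -1]) (by simp)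
  simp [Matrix.mulVec, dotProduct, Fin.sum_univ_two] at hp hm ⊢
  constructor <;> linarith

/-- The two real `2 × 2` matrices attached to a symplectic matrix of the displayed shape have
determinant one. -/
theorem det_eq_one_of_mem_Sp4 {ε a1 a2 b1 b2 c1 c2 d1 d2 : ℝ} (hε : ε = 1 ∨ ε = -1)
    (hM : !![a1, a2, b1, b2;
             ε*a2, ε*a1, ε*b2, ε*b1;
             c1, c2, d1, d2;
             ε*c2, ε*c1, ε*d2, ε*d1] ∈ Sp4) :
    (a1 + a2) * (d1 + d2) - (b1 + b2) * (c1 + c2) = 1 ∧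
      (a1 - a2) * (d1 - d2) - (b1 - b2) * (c1 - c2) = 1 := by
  have h02 := congrFun (congrFun hM.2 0) 2
  have h03 := congrFun (congrFun hM.2 0) 3
  simp [J4, Matrix.mul_apply, Fin.sum_univ_four] at h02 h03
  rcases hε with rfl | rfl <;> constructor <;> linarith

/-- for `M ∈ Ĝ` of the displayed shape and
`Ω = [[τ,z],[z,τ]] ∈ Ĥ₂`, `M⟨Ω⟩ = [[τ*, z*], [z*, τ*]]` with
`τ* = (M₁⟨τ+z⟩ + M₂⟨τ-z⟩)/2` and `z* = ε(M₁⟨τ+z⟩ - M₂⟨τ-z⟩)/2`. -/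
theorem statement14 (ε a1 a2 b1 b2 c1 c2 d1 d2 : ℝ) (hε : ε = 1 ∨ ε = -1)
    (hM : !![a1, a2, b1, b2;
             ε*a2, ε*a1, ε*b2, ε*b1;
             c1, c2, d1, d2;
             ε*c2, ε*c1, ε*d2, ε*d1] ∈ GHat)
    (τ z : ℂ) (hΩ : !![τ, z; z, τ] ∈ HHat2) :
    act !![a1, a2, b1, b2;
           ε*a2, ε*a1, ε*b2, ε*b1;
           c1, c2, d1, d2;
           ε*c2, ε*c1, ε*d2, ε*d1] !![τ, z; z, τ] =
      !![(moebius !![a1+a2, b1+b2; c1+c2, d1+d2] (τ+z) +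
            moebius !![a1-a2, b1-b2; c1-c2, d1-d2] (τ-z)) / 2,
         (ε : ℂ) * (moebius !![a1+a2, b1+b2; c1+c2, d1+d2] (τ+z) -
            moebius !![a1-a2, b1-b2; c1-c2, d1-d2] (τ-z)) / 2;
         (ε : ℂ) * (moebius !![a1+a2, b1+b2; c1+c2, d1+d2] (τ+z) -
            moebius !![a1-a2, b1-b2; c1-c2, d1-d2] (τ-z)) / 2,
         (moebius !![a1+a2, b1+b2; c1+c2, d1+d2] (τ+z) +
            moebius !![a1-a2, b1-b2; c1-c2, d1-d2] (τ-z)) / 2] := by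
  obtain ⟨h1, h2⟩ := det_eq_one_of_mem_Sp4 hε hM.1
  obtain ⟨hp, hm⟩ := im_add_pos_and_im_sub_pos_of_mem_H2 hΩ.1
  have hP := linear_form_ne_zero_of_im_pos h1 hp
  have hN := linear_form_ne_zero_of_im_pos h2 hm
  push_cast at hP hN
  have hε2 : (ε : ℂ) * ε = 1 := by rcases hε with rfl | rfl <;> simp
  have hC : blkC !![a1, a2, b1, b2; ε*a2, ε*a1, ε*b2, ε*b1; c1, c2, d1, d2;
        ε*c2, ε*c1, ε*d2, ε*d1] * !![τ, z; z, τ] +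
      blkD !![a1, a2, b1, b2; ε*a2, ε*a1, ε*b2, ε*b1; c1, c2, d1, d2;
        ε*c2, ε*c1, ε*d2, ε*d1] =
      !![c1 * τ + c2 * z + d1, c1 * z + c2 * τ + d2;
        ε * (c2 * τ + c1 * z + d2), ε * (c2 * z + c1 * τ + d1)] := by
    ext i j
    fin_cases i <;> fin_cases j <;>
      simp [blkC, blkD, Matrix.mul_apply, Fin.sum_univ_two] <;> ring
  have hA : blkA !![a1, a2, b1, b2; ε*a2, ε*a1, ε*b2, ε*b1; c1, c2, d1, d2;
        ε*c2, ε*c1, ε*d2, ε*d1] * !![τ, z; z, τ] +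
      blkB !![a1, a2, b1, b2; ε*a2, ε*a1, ε*b2, ε*b1; c1, c2, d1, d2;
        ε*c2, ε*c1, ε*d2, ε*d1] =
      !![a1 * τ + a2 * z + b1, a1 * z + a2 * τ + b2;
        ε * (a2 * τ + a1 * z + b2), ε * (a2 * z + a1 * τ + b1)] := by
    ext i j
    fin_cases i <;> fin_cases j <;>
      simp [blkA, blkB, Matrix.mul_apply, Fin.sum_univ_two] <;> ring
  have hdet : IsUnit (!![c1 * τ + c2 * z + d1, c1 * z + c2 * τ + d2;
      ε * (c2 * τ + c1 * z + d2), ε * (c2 * z + c1 * τ + d1)] :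
        Matrix (Fin 2) (Fin 2) ℂ).det := by
    have hεne : (ε : ℂ) ≠ 0 := left_ne_zero_of_mul_eq_one hε2
    rw [isUnit_iff_ne_zero, Matrix.det_fin_two_of]
    convert mul_ne_zero hεne (mul_ne_zero hP hN) using 1
    ring
  have key : ∀ {X Y Z : Matrix (Fin 2) (Fin 2) ℂ}, IsUnit Y.det → X = Z * Y → X * Y⁻¹ = Z := by
    rintro X Y Z hY rfl
    exact Matrix.mul_nonsing_inv_cancel_right _ _ hY
  rw [act, hA, hC]
  refine key hdet ?_
  obtain ⟨p, hp'⟩ : ∃ p, p = moebius !![a1+a2, b1+b2; c1+c2, d1+d2] (τ+z) := ⟨_, rfl⟩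
  obtain ⟨m, hm'⟩ : ∃ m, m = moebius !![a1-a2, b1-b2; c1-c2, d1-d2] (τ-z) := ⟨_, rfl⟩
  rw [← hp', ← hm']
  simp only [moebius] at hp' hm'
  simp at hp' hm'
  rw [eq_div_iff hP] at hp'
  rw [eq_div_iff hN] at hm'
  ext i j
  fin_cases i <;> fin_cases j <;> simp [Matrix.mul_apply, Fin.sum_univ_two]
  · linear_combination -(hp' + hm') / 2 - (p - m) / 2 * (c2 * τ + c1 * z + d2) * hε2
  · linear_combination -(hp' - hm') / 2 - (p - m) / 2 * (c2 * z + c1 * τ + d1) * hε2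
  · linear_combination -ε * (hp' - hm') / 2
  · linear_combination -ε * (hp' + hm') / 2

end
end
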